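/- (Non-solvability is stable under separable base change.) Let k ⊆ K be fields, let k' be a separable algebraic field extension of k, and let ν, δ be positive integers. Let φ = X₁^ν + Σ_{i=1}^{ν} c_i X₁^{ν−i} X₂^{δ·i} ∈ K[X₁,X₂] with c₁,…,c_ν ∈ K. If the image φ_s of φ in (K ⊗_k k')[X₁,X₂] satisfies φ_s = (X₁ + α X₂^{δ})^ν for some nonzero α ∈ K ⊗_k k', then there exists a nonzero λ ∈ K with φ = (X₁ + λ X₂^{δ})^ν in K[X₁,X₂]. -/

import Mathlib

open TensorProduct

/-- In the base change of a separable algebraic extension, an element with a `p`-power power in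
the base field lies in the base field, where `p` is the exponential characteristic. -/
theorem exists_algebraMap_eq_of_pow_expChar_pow_eq {k K k' : Type*} [Field k] [Field K] [Field k']
    [Algebra k K] [Algebra k k'] [Algebra.IsSeparable k k'] (p n : ℕ) [ExpChar k p]
    {α : K ⊗[k] k'} {a : K} (h : α ^ p ^ n = algebraMap K (K ⊗[k] k') a) :
    ∃ r : K, algebraMap K (K ⊗[k] k') r = α := by
  classical
  have : ExpChar k' p := expChar_of_injective_algebraMap (algebraMap k k').injective p
  have : ExpChar (K ⊗[k] k') p :=
    expChar_of_injective_algebraMap (algebraMap k (K ⊗[k] k')).injective p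
  have hq : p ^ n ≠ 0 := pow_ne_zero _ (expChar_pos k p).ne'
  have h1 : LinearIndepOn k id ({1} : Set k') := LinearIndepOn.singleton one_ne_zero
  let b := Module.Basis.extend h1
  let i₀ : h1.extend (Set.subset_univ _) := ⟨1, Module.Basis.subset_extend h1 rfl⟩
  have hb : b i₀ = 1 := Module.Basis.extend_apply_self h1 i₀
  let b' := b.mapPowExpCharPowOfIsSeparable p n
  have hb' (i) : b' i = b i ^ p ^ n := by
    simp [b', Module.Basis.mapPowExpCharPowOfIsSeparable]
  let B := Algebra.TensorProduct.basis K b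
  let B' := Algebra.TensorProduct.basis K b'
  have hB (i) : B i ^ p ^ n = B' i := by
    simp [B, B', hb', Algebra.TensorProduct.tmul_pow]
  have hB₀ : B i₀ = 1 := by simp [B, hb, Algebra.TensorProduct.one_def]
  have hB₀' : B' i₀ = 1 := by rw [← hB, hB₀, one_pow]
  have hα : α = ∑ i ∈ (B.repr α).support, B.repr α i • B i :=
    (B.linearCombination_repr α).symm
  have hpow : ∑ i ∈ (B.repr α).support, B.repr α i ^ p ^ n • B' i = a • B' i₀ := by
    rw [hB₀', ← Algebra.algebraMap_eq_smul_one, ← h]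
    conv_rhs => rw [hα, ← iterateFrobenius_def, map_sum]
    exact Finset.sum_congr rfl fun i _ ↦ by rw [iterateFrobenius_def, smul_pow, hB]
  have hzero (i) (hi : i ≠ i₀) : B.repr α i = 0 := by
    by_contra hne
    have := congrArg (fun x ↦ B'.repr x i) hpow
    simp [Finsupp.single_apply, hi.symm, hne] at this
  refine ⟨B.repr α i₀, ?_⟩
  rw [Algebra.algebraMap_eq_smul_one, ← hB₀]
  refine B.repr.injective (Finsupp.ext fun i ↦ ?_)
  by_cases hi : i = i₀
  · simp [hi]
  · simp [hzero i hi, Ne.symm hi]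

open Polynomial in
/-- If the coefficients of `(X + α) ^ ν` come from a field of exponential characteristic `p`,
then so does some `p`-power power of `α`. -/
theorem exists_pow_expChar_pow_eq_algebraMap {K R : Type*} [Field K] [CommRing R] [Nontrivial R]
    [Algebra K R] (p : ℕ) [ExpChar K p] {ν : ℕ} (hν : ν ≠ 0) {f : K[X]} {α : R}
    (h : f.map (algebraMap K R) = (X + C α) ^ ν) :
    ∃ (n : ℕ) (a : K), α ^ p ^ n = algebraMap K R a := by
  have : ExpChar R p := expChar_of_injective_algebraMap (algebraMap K R).injective p
  obtain ⟨n, m, hm, rfl⟩ : ∃ n m : ℕ, (m : K) ≠ 0 ∧ ν = p ^ n * m := by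
    rcases ‹ExpChar K p› with _ | hp
    · exact ⟨0, ν, Nat.cast_ne_zero.2 hν, by simp⟩
    · obtain ⟨n, m, hm, rfl⟩ := Nat.exists_eq_pow_mul_and_not_dvd hν p hp.ne_one
      exact ⟨n, m, fun h0 ↦ hm ((CharP.cast_eq_zero_iff K p m).1 h0), rfl⟩
  have hq : 0 < p ^ n := pow_pos (expChar_pos K p) n
  have hm0 : m ≠ 0 := by rintro rfl; simp at hm
  have hexp : (X + C α) ^ (p ^ n * m) = expand R (p ^ n) ((X + C (α ^ p ^ n)) ^ m) := by
    rw [pow_mul, add_pow_expChar_pow]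
    simp
  have hcoeff := congrArg (fun g ↦ g.coeff ((m - 1) * p ^ n)) (h.trans hexp)
  obtain ⟨m, rfl⟩ := Nat.exists_eq_succ_of_ne_zero hm0
  simp only [coeff_map, coeff_expand_mul hq, coeff_X_add_C_pow, Nat.succ_eq_add_one,
    Nat.add_sub_cancel, Nat.add_sub_cancel_left, pow_one, Nat.choose_succ_self_right] at hcoeff
  refine ⟨n, f.coeff (m * p ^ n) * ((m + 1 : ℕ) : K)⁻¹, ?_⟩
  rw [map_mul, hcoeff, mul_assoc, ← map_natCast (algebraMap K R), ← map_mul, mul_inv_cancel₀ hm,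
    map_one, mul_one]

/-- non-solvability is stable under separable base change: let `k ⊆ K` be
fields, `k'` a separable algebraic extension of `k`, `ν, δ` positive integers, and
`φ = X₁^ν + Σ_{i=1}^{ν} c_i X₁^{ν-i} X₂^{δ·i} ∈ K[X₁,X₂]`. If the image `φ_s` of `φ` in
`(K ⊗_k k')[X₁,X₂]` equals `(X₁ + α X₂^δ)^ν` for some nonzero `α`, then already
`φ = (X₁ + λ X₂^δ)^ν` for some nonzero `λ ∈ K`. -/
theorem stmt10 {k K k' : Type*} [Field k] [Field K] [Field k']
    [Algebra k K] [Algebra k k'] [Algebra.IsSeparable k k']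
    (ν δ : ℕ) (hν : 0 < ν) (hδ : 0 < δ) (c : ℕ → K)
    (φ : MvPolynomial (Fin 2) K)
    (hφ : φ = MvPolynomial.X 0 ^ ν +
      ∑ i ∈ Finset.Icc 1 ν,
        MvPolynomial.C (c i) * MvPolynomial.X 0 ^ (ν - i) * MvPolynomial.X 1 ^ (δ * i))
    (α : K ⊗[k] k') (hα : α ≠ 0)
    (hsplit : MvPolynomial.map (algebraMap K (K ⊗[k] k')) φ =
      (MvPolynomial.X 0 + MvPolynomial.C α * MvPolynomial.X 1 ^ δ) ^ ν) :
    ∃ lam : K, lam ≠ 0 ∧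
      φ = (MvPolynomial.X 0 + MvPolynomial.C lam * MvPolynomial.X 1 ^ δ) ^ ν := by
  obtain ⟨p, hp⟩ := ExpChar.exists k
  have : ExpChar K p := expChar_of_injective_algebraMap (algebraMap k K).injective p
  have hf : (MvPolynomial.aeval ![Polynomial.X, 1] φ : Polynomial K).map
      (algebraMap K (K ⊗[k] k')) = (Polynomial.X + Polynomial.C α) ^ ν := by
    have h := congrArg (MvPolynomial.aeval (R := K ⊗[k] k')
      ![(Polynomial.X : Polynomial (K ⊗[k] k')), 1]) hsplit
    simp only [map_pow, map_add, map_mul, MvPolynomial.aeval_X, MvPolynomial.aeval_C] at h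
    rw [hφ] at h ⊢
    simpa [Polynomial.algebraMap_eq, Polynomial.map_sum] using h
  obtain ⟨n, a, ha⟩ := exists_pow_expChar_pow_eq_algebraMap p hν.ne' hf
  obtain ⟨lam, rfl⟩ := exists_algebraMap_eq_of_pow_expChar_pow_eq p n ha
  refine ⟨lam, fun h0 ↦ hα (by rw [h0, map_zero]), ?_⟩
  apply MvPolynomial.map_injective _ (algebraMap K (K ⊗[k] k')).injective
  rw [hsplit]
  simp
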